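/- arXiv:2305.04481 — 2 statements merged into one kernel-verified Lean document; each statement's English description precedes it below -/
import Mathlib

section
/- For every 9×9 complex matrix ρ, the twirled matrix ρ' := (1/16) Σ_{m=0}^{3} Σ_{n=0}^{3} U_{mn} ρ U_{mn} is a diagonal matrix whose diagonal entries coincide with those of ρ: ρ'_{ii} = ρ_{ii} for all i and ρ'_{ij} = 0 for all i ≠ j. -/
open Matrix Finset

noncomputable section

/-- Kronecker product of two `3×3` matrices as a `9×9` matrix, with the index convention
`|ij⟩ = e_{3i+j}`: the `(3i+j, 3k+l)` entry is `A i k * B j l`. -/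
def kron (A B : Matrix (Fin 3) (Fin 3) ℂ) : Matrix (Fin 9) (Fin 9) ℂ :=
  Matrix.of fun i j =>
    A ⟨i.val / 3, by have := i.isLt; omega⟩ ⟨j.val / 3, by have := j.isLt; omega⟩ *
    B ⟨i.val % 3, by have := i.isLt; omega⟩ ⟨j.val % 3, by have := j.isLt; omega⟩

/-- The sign matrices `𝚅₀ = I₃`, `𝚅₁ = diag(1,1,-1)`, `𝚅₂ = diag(1,-1,1)`,
`𝚅₃ = diag(-1,1,1)`. -/
def Vsign : Fin 4 → Matrix (Fin 3) (Fin 3) ℂ :=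
  ![1, Matrix.diagonal ![1, 1, -1], Matrix.diagonal ![1, -1, 1], Matrix.diagonal ![-1, 1, 1]]

/-- `U_{mn} = 𝚅_m ⊗ 𝚅_n`. -/
def Umn (m n : Fin 4) : Matrix (Fin 9) (Fin 9) ℂ := kron (Vsign m) (Vsign n)

/-- The twirl `ρ' = (1/16) ∑_{m,n} U_{mn} ρ U_{mn}`. -/
def twirl (ρ : Matrix (Fin 9) (Fin 9) ℂ) : Matrix (Fin 9) (Fin 9) ℂ :=
  (1 / 16 : ℂ) • ∑ m : Fin 4, ∑ n : Fin 4, Umn m n * ρ * Umn m n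

/-- The diagonal of `Vsign m`. -/
def sgn3 : Fin 4 → Fin 3 → ℂ :=
  ![![1, 1, 1], ![1, 1, -1], ![1, -1, 1], ![-1, 1, 1]]

lemma Vsign_eq (m : Fin 4) : Vsign m = Matrix.diagonal (sgn3 m) := by
  ext a b
  fin_cases m <;> fin_cases a <;> fin_cases b <;> simp [Vsign, sgn3]

/-- Orthogonality of the sign vectors. -/
lemma sgn3_orth (a b : Fin 3) : ∑ m, sgn3 m a * sgn3 m b = if a = b then 4 else 0 := by
  fin_cases a <;> fin_cases b <;> simp [sgn3, Fin.sum_univ_four] <;> norm_num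

def hi (i : Fin 9) : Fin 3 := ⟨i.val / 3, by have := i.isLt; omega⟩

def lo (i : Fin 9) : Fin 3 := ⟨i.val % 3, by have := i.isLt; omega⟩

lemma hi_lo (i j : Fin 9) (h : hi i = hi j) (h' : lo i = lo j) : i = j := by
  simp only [hi, lo, Fin.mk.injEq] at h h'
  ext
  omega

lemma Umn_eq (m n : Fin 4) :
    Umn m n = Matrix.diagonal fun i => sgn3 m (hi i) * sgn3 n (lo i) := by
  ext i j
  change Vsign m (hi i) (hi j) * Vsign n (lo i) (lo j) = _
  rw [Vsign_eq, Vsign_eq]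
  by_cases hij : i = j
  · subst hij
    simp
  · rw [Matrix.diagonal_apply_ne _ hij]
    by_cases h : hi i = hi j
    · have h' : lo i ≠ lo j := fun h' => hij (hi_lo i j h h')
      rw [Matrix.diagonal_apply_ne _ h', mul_zero]
    · rw [Matrix.diagonal_apply_ne _ h, zero_mul]

lemma twirl_apply (ρ : Matrix (Fin 9) (Fin 9) ℂ) (i j : Fin 9) :
    twirl ρ i j = (1 / 16 : ℂ) * (((if hi i = hi j then 4 else 0) *
      (if lo i = lo j then 4 else 0)) * ρ i j) := by
  rw [← sgn3_orth, ← sgn3_orth, Finset.sum_mul_sum, Finset.sum_mul]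
  simp only [twirl, Matrix.smul_apply, Matrix.sum_apply, smul_eq_mul, Finset.sum_mul]
  congr 1
  refine Finset.sum_congr rfl fun m _ => Finset.sum_congr rfl fun n _ => ?_
  rw [Umn_eq, Matrix.mul_diagonal, Matrix.diagonal_mul]
  ring

/-- for every `9×9` complex matrix `ρ`, the twirled matrix
`ρ' = (1/16) ∑_{m,n} U_{mn} ρ U_{mn}` is diagonal with the same diagonal entries as `ρ`. -/
theorem twirl_is_diagonal (ρ : Matrix (Fin 9) (Fin 9) ℂ) :
    (∀ i : Fin 9, twirl ρ i i = ρ i i) ∧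
    (∀ i j : Fin 9, i ≠ j → twirl ρ i j = 0) := by
  refine ⟨fun i => ?_, fun i j hij => ?_⟩
  · rw [twirl_apply, if_pos rfl, if_pos rfl]
    ring
  · rw [twirl_apply]
    by_cases h : hi i = hi j
    · have h' : lo i ≠ lo j := fun h' => hij (hi_lo i j h h')
      rw [if_neg h']
      ring
    · rw [if_neg h]
      ring
end
end

section
/- The function g : [0,1] → ℝ defined by g(x) = H₂((1 + √(1 - x²))/2) is convex on the interval [0,1], where H₂ denotes the binary entropy function. -/
noncomputable section

/-- The binary entropy function `H₂(t) = -t log t - (1-t) log(1-t)` (natural logarithm;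
note `Real.log 0 = 0`, so this matches the extension `H₂(0) = H₂(1) = 0`). -/
def H2 (t : ℝ) : ℝ := -t * Real.log t - (1 - t) * Real.log (1 - t)

lemma aux_log {s : ℝ} (h0 : 0 < s) (h1 : s < 1) :
    2 * s ≤ Real.log (1 + s) - Real.log (1 - s) := by
  have h := Real.hasSum_log_sub_log_of_abs_lt_one (x := s) (by rw [abs_of_pos h0]; exact h1)
  have := sum_le_hasSum {0} (fun i _ => by positivity) h
  simpa using this

lemma aux_sqrt {x : ℝ} (hx : x ∈ Set.Ioo (0:ℝ) 1) :
    0 < Real.sqrt (1 - x ^ 2) ∧ Real.sqrt (1 - x ^ 2) < 1 ∧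
    Real.sqrt (1 - x ^ 2) ^ 2 = 1 - x ^ 2 ∧
    HasDerivAt (fun x : ℝ => Real.sqrt (1 - x ^ 2)) (-x / Real.sqrt (1 - x ^ 2)) x := by
  obtain ⟨h0, h1⟩ := hx
  have hp : 0 < 1 - x ^ 2 := by nlinarith
  have hs : 0 < Real.sqrt (1 - x ^ 2) := Real.sqrt_pos.2 hp
  refine ⟨hs, ?_, Real.sq_sqrt hp.le, ?_⟩
  · rw [Real.sqrt_lt' one_pos]; nlinarith
  · have h := (((hasDerivAt_id x).pow 2).const_sub 1).sqrt hp.ne'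
    refine h.congr_deriv ?_
    simp
    field_simp

lemma H2_eq : H2 = Real.binEntropy := by
  funext t
  rw [Real.binEntropy_eq_negMulLog_add_negMulLog_one_sub, H2, Real.negMulLog, Real.negMulLog]
  ring

/-- the function `g(x) = H₂((1 + √(1 - x²))/2)` is convex on `[0,1]`. -/
theorem binEntropy_comp_convex :
    ConvexOn ℝ (Set.Icc (0:ℝ) 1) (fun x => H2 ((1 + Real.sqrt (1 - x ^ 2)) / 2)) := by
  rw [H2_eq]
  refine convexOn_of_hasDerivWithinAt2_nonneg (convex_Icc 0 1)
    (f' := fun x => x / (2 * Real.sqrt (1 - x ^ 2)) *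
      (Real.log (1 + Real.sqrt (1 - x ^ 2)) - Real.log (1 - Real.sqrt (1 - x ^ 2))))
    (f'' := fun x => (Real.log (1 + Real.sqrt (1 - x ^ 2)) - Real.log (1 - Real.sqrt (1 - x ^ 2)))
      / (2 * Real.sqrt (1 - x ^ 2) ^ 3) - 1 / Real.sqrt (1 - x ^ 2) ^ 2) ?_ ?_ ?_ ?_
  · exact (Real.binEntropy_continuous.comp (by fun_prop)).continuousOn
  · rw [interior_Icc]
    intro x hx
    obtain ⟨h0, h1, h2, hd⟩ := aux_sqrt hx
    apply HasDerivAt.hasDerivWithinAt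
    have hb := Real.hasDerivAt_binEntropy (p := (1 + Real.sqrt (1 - x ^ 2)) / 2)
      (by positivity) (by linarith)
    refine (hb.comp x ((hd.const_add 1).div_const 2)).congr_deriv ?_
    set s := Real.sqrt (1 - x ^ 2)
    have e : 1 - (1 + s) / 2 = (1 - s) / 2 := by ring
    rw [e, Real.log_div (by linarith) two_ne_zero, Real.log_div (by linarith) two_ne_zero]
    field_simp
    ring
  · rw [interior_Icc]
    intro x hx
    obtain ⟨h0, h1, h2, hd⟩ := aux_sqrt hx
    apply HasDerivAt.hasDerivWithinAt
    have hL := ((hd.const_add 1).log (by positivity)).sub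
      ((hd.const_sub 1).log (by linarith))
    have hq := (hasDerivAt_id x).div (hd.const_mul 2) (by positivity)
    refine (hq.mul hL).congr_deriv ?_
    have hx0 : x ≠ 0 := hx.1.ne'
    simp only [id, Pi.sub_apply, Pi.div_apply]
    set s := Real.sqrt (1 - x ^ 2)
    have hm : 1 - s ≠ 0 := by linarith
    have hp : 1 + s ≠ 0 := by linarith
    have e1 : (1 * (2 * s) - x * (2 * (-x / s))) / (2 * s) ^ 2 = 1 / (2 * s ^ 3) := by
      field_simp
      linear_combination h2
    have e2 : (-x / s) / (1 + s) - -(-x / s) / (1 - s) = - 2 / (x * s) := by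
      field_simp
      linear_combination (-2) * h2
    rw [e1, e2]
    field_simp
    ring
  · rw [interior_Icc]
    intro x hx
    obtain ⟨h0, h1, h2, hd⟩ := aux_sqrt hx
    have := aux_log h0 h1
    set s := Real.sqrt (1 - x ^ 2)
    rw [sub_nonneg, div_le_div_iff₀ (by positivity) (by positivity)]
    nlinarith [mul_le_mul_of_nonneg_right this (sq_nonneg s)]
end
end
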